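/- For every dense G_δ-set G in I^ω and every σZ-set F ⊆ I^ω of finite covering dimension at most k, the set H^{k+1}_{F,G} = {(h₁,…,h_{k+1}) ∈ H(I^ω)^{k+1} : F ⊆ h₁(G) ∪ … ∪ h_{k+1}(G)} is a dense G_δ-set in H(I^ω)^{k+1}. -/

import Mathlib

open Set Topology Cardinal

/-- The Hilbert cube `[0,1]^ℕ` with the product topology. -/
abbrev HilbertCube : Type := ℕ → ↥(Set.Icc (0:ℝ) 1)

/-- An ideal of subsets: a nonempty family closed under subsets and finite unions. -/
def IsIdeal {X : Type*} (I : Set (Set X)) : Prop :=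
  I.Nonempty ∧ (∀ A ∈ I, ∀ B, B ⊆ A → B ∈ I) ∧ (∀ A ∈ I, ∀ B ∈ I, A ∪ B ∈ I)

/-- A σ-ideal: an ideal closed under countable unions. -/
def IsSigmaIdeal {X : Type*} (I : Set (Set X)) : Prop :=
  IsIdeal I ∧ ∀ A : ℕ → Set X, (∀ n, A n ∈ I) → (⋃ n, A n) ∈ I

/-- A non-trivial ideal contains an uncountable set but not the whole space. -/
def NontrivialIdeal {X : Type*} (I : Set (Set X)) : Prop :=
  (∃ A ∈ I, ¬ A.Countable) ∧ Set.univ ∉ I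

/-- An ideal on a topological space is topologically invariant if it is preserved by
all homeomorphisms of the space. -/
def TopInvariant {X : Type*} [TopologicalSpace X] (I : Set (Set X)) : Prop :=
  ∀ h : X ≃ₜ X, {B | ∃ A ∈ I, B = h '' A} = I

/-- `I` has a base all of whose members satisfy `P`. -/
def HasBaseWith {X : Type*} (I : Set (Set X)) (P : Set X → Prop) : Prop :=
  ∃ B ⊆ I, (∀ A ∈ I, ∃ C ∈ B, A ⊆ C) ∧ ∀ C ∈ B, P C

/-- A set has the Baire property if it differs from some open set by a meager set. -/
def HasBaireProperty {X : Type*} [TopologicalSpace X] (A : Set X) : Prop :=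
  ∃ U : Set X, IsOpen U ∧ IsMeagre ((A \ U) ∪ (U \ A))

/-- The σ-ideal of meager subsets of a topological space. -/
def MeagerIdeal (X : Type*) [TopologicalSpace X] : Set (Set X) := {A | IsMeagre A}

/-- The σ-ideal generated by a family `F`: all subsets of countable unions of members
of `F`. -/
def sigmaGenerated {X : Type*} (F : Set (Set X)) : Set (Set X) :=
  {A | ∃ S : ℕ → Set X, (∀ n, S n ∈ F) ∧ A ⊆ ⋃ n, S n}

/-- A Cantor set in the Hilbert cube: a subset homeomorphic to the Cantor cube. -/
def IsCantorSet (C : Set HilbertCube) : Prop := Nonempty (C ≃ₜ (ℕ → Bool))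

/-- A minimal Cantor set: one that can be mapped into any other Cantor set by an
ambient homeomorphism. -/
def IsMinimalCantorSet (A : Set HilbertCube) : Prop :=
  IsCantorSet A ∧ ∀ B : Set HilbertCube, IsCantorSet B →
    ∃ h : HilbertCube ≃ₜ HilbertCube, h '' A ⊆ B

/-- The family of all minimal Cantor sets in the Hilbert cube. -/
def CantorFamily : Set (Set HilbertCube) := {A | IsMinimalCantorSet A}

/-- The σ-ideal generated by minimal Cantor sets. -/
def sigmaC0 : Set (Set HilbertCube) := sigmaGenerated CantorFamily

/-- A minimal dense Gδ-subset of the Hilbert cube. -/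
def IsMinimalDenseGdelta (A : Set HilbertCube) : Prop :=
  IsGδ A ∧ Dense A ∧ ∀ B : Set HilbertCube, IsGδ B → Dense B →
    ∃ h : HilbertCube ≃ₜ HilbertCube, h '' A ⊆ B

/-- The family of all minimal dense Gδ-sets in the Hilbert cube. -/
def GdeltaFamily : Set (Set HilbertCube) := {A | IsMinimalDenseGdelta A}

/-- The σ-ideal generated by minimal dense Gδ-sets. -/
def sigmaG0 : Set (Set HilbertCube) := sigmaGenerated GdeltaFamily

/-- `cov(I)`: the least cardinality of a subfamily of `I` covering the space. -/
noncomputable def covIdeal {X : Type*} (I : Set (Set X)) : Cardinal :=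
  sInf {c | ∃ A : Set (Set X), A ⊆ I ∧ ⋃₀ A = Set.univ ∧ c = #A}

/-- `non(I)`: the least cardinality of a subset of the space not in `I`. -/
noncomputable def nonIdeal {X : Type*} (I : Set (Set X)) : Cardinal :=
  sInf {c | ∃ A : Set X, A ∉ I ∧ c = #A}

/-- `add(I,J)`: the least cardinality of a subfamily of `I` whose union is not in `J`. -/
noncomputable def addIdeal2 {X : Type*} (I J : Set (Set X)) : Cardinal :=
  sInf {c | ∃ A : Set (Set X), A ⊆ I ∧ ⋃₀ A ∉ J ∧ c = #A}

/-- `add(I) = add(I,I)`. -/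
noncomputable def addIdeal {X : Type*} (I : Set (Set X)) : Cardinal := addIdeal2 I I

/-- `cof(I,J)`: the least cardinality of a subfamily of `J` cofinal in `I`. -/
noncomputable def cofIdeal2 {X : Type*} (I J : Set (Set X)) : Cardinal :=
  sInf {c | ∃ A : Set (Set X), A ⊆ J ∧ (∀ B ∈ I, ∃ C ∈ A, B ⊆ C) ∧ c = #A}

/-- `cof(I) = cof(I,I)`. -/
noncomputable def cofIdeal {X : Type*} (I : Set (Set X)) : Cardinal := cofIdeal2 I I

/-- The compact-open topology on the homeomorphism group of a space, induced by the
compact-open topology of the space of continuous self-maps. -/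
noncomputable instance homeoGroupTopology (X : Type*) [TopologicalSpace X] :
    TopologicalSpace (X ≃ₜ X) :=
  TopologicalSpace.induced (fun h : X ≃ₜ X => (⟨h, h.continuous⟩ : C(X, X)))
    ContinuousMap.compactOpen

/-- A Z-set: a closed set `A` such that for every open cover `U` of the space there is a
continuous map into the complement of `A` which is `U`-near to the identity. -/
def IsZSet {X : Type*} [TopologicalSpace X] (A : Set X) : Prop :=
  IsClosed A ∧ ∀ U : Set (Set X), (∀ V ∈ U, IsOpen V) → ⋃₀ U = Set.univ →
    ∃ f : C(X, X), (∀ x, f x ∉ A) ∧ ∀ x : X, ∃ V ∈ U, x ∈ V ∧ f x ∈ V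

/-- A σZ-set: a countable union of Z-sets. -/
def IsSigmaZSet {X : Type*} [TopologicalSpace X] (A : Set X) : Prop :=
  ∃ Z : ℕ → Set X, (∀ n, IsZSet (Z n)) ∧ A = ⋃ n, Z n

/-- The cube `[0,1]^n`. -/
abbrev FinCube (n : ℕ) : Type := Fin n → ↥(Set.Icc (0:ℝ) 1)

/-- A `Z_n`-set in the Hilbert cube: a closed set `A` such that maps avoiding `A` are
dense in the space `C([0,1]^n, I^ω)` with the compact-open topology. -/
def IsZnSet (n : ℕ) (A : Set HilbertCube) : Prop :=
  IsClosed A ∧ Dense {f : C(FinCube n, HilbertCube) | ∀ x, f x ∉ A}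

/-- A `Z_ω`-set in the Hilbert cube: a closed set which is a `Z_n`-set for all `n`. -/
def IsZomegaSet (A : Set HilbertCube) : Prop :=
  IsClosed A ∧ ∀ n : ℕ, IsZnSet n A

/-- Covering dimension of a space is at most `n`: every finite open cover has a finite
open refinement (still a cover) in which no point belongs to more than `n+1` members. -/
def CovDimLE (Y : Type*) [TopologicalSpace Y] (n : ℕ) : Prop :=
  ∀ U : Set (Set Y), U.Finite → (∀ V ∈ U, IsOpen V) → ⋃₀ U = Set.univ →
    ∃ V : Set (Set Y), V.Finite ∧ (∀ W ∈ V, IsOpen W) ∧ ⋃₀ V = Set.univ ∧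
      (∀ W ∈ V, ∃ W' ∈ U, W ⊆ W') ∧
      ∀ y : Y, {W ∈ V | y ∈ W}.ncard ≤ n + 1

/-- A `G_δ`-generated topologically invariant ideal on the Hilbert cube. -/
def GdeltaGenerated (I : Set (Set HilbertCube)) : Prop :=
  HasBaseWith I IsSigmaCompact ∧
  ∃ G : Set HilbertCube, IsGδ G ∧
    (∀ K : Set HilbertCube, K ⊆ G → IsCompact K → K ∈ I) ∧
    ∀ A ∈ I, IsCompact A →
      Dense {h : HilbertCube ≃ₜ HilbertCube | h '' A ⊆ G}

/-- A `G_δ*`-generated ideal: a preimage of a `G_δ`-generated ideal under an embedding. -/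
def GdeltaStarGenerated (I : Set (Set HilbertCube)) : Prop :=
  ∃ I' : Set (Set HilbertCube), GdeltaGenerated I' ∧
    ∃ e : HilbertCube → HilbertCube, IsEmbedding e ∧ I = {S | ∃ A ∈ I', S = e ⁻¹' A}

/-- A `σG_δ*`-generated ideal. -/
def SigmaGdeltaStarGenerated (I : Set (Set HilbertCube)) : Prop :=
  ∃ In : ℕ → Set (Set HilbertCube), (∀ n, GdeltaStarGenerated (In n)) ∧
    (∀ n, In n ⊆ I) ∧
    ∀ A ∈ I, ∃ K : ℕ → Set HilbertCube,
      (∀ n, IsCompact (K n) ∧ K n ∈ In n) ∧ A ⊆ ⋃ n, K n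

/-- Two points of the Hilbert cube are `r`-close in the first `n` coordinates. -/
def CoordClose (n : ℕ) (r : ℝ) (x y : HilbertCube) : Prop :=
  ∀ i < n, |(x i : ℝ) - y i| ≤ r

theorem CoordClose.symm {n : ℕ} {r : ℝ} {x y : HilbertCube} (h : CoordClose n r x y) :
    CoordClose n r y x := fun i hi => by
  rw [abs_sub_comm]; exact h i hi

theorem CoordClose.trans {n : ℕ} {r s : ℝ} {x y z : HilbertCube} (h : CoordClose n r x y)
    (h' : CoordClose n s y z) : CoordClose n (r + s) x z := fun i hi =>
  (abs_sub_le _ _ _).trans (add_le_add (h i hi) (h' i hi))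

theorem CoordClose.mono {n m : ℕ} {r s : ℝ} {x y : HilbertCube} (h : CoordClose n r x y)
    (hm : m ≤ n) (hr : r ≤ s) : CoordClose m s x y := fun i hi =>
  (h i (hi.trans_le hm)).trans hr

theorem coordClose_mem_uniformity (n : ℕ) {r : ℝ} (hr : 0 < r) :
    {p : HilbertCube × HilbertCube | CoordClose n r p.1 p.2} ∈ uniformity HilbertCube := by
  have h : ∀ i ∈ Finset.range n,
      {p : HilbertCube × HilbertCube | |(p.1 i : ℝ) - p.2 i| ≤ r} ∈ uniformity HilbertCube := by
    intro i _
    filter_upwards [Pi.uniformContinuous_proj (fun _ : ℕ => ↥(Icc (0 : ℝ) 1)) i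
      (Metric.dist_mem_uniformity hr)] with p hp
    exact le_of_lt hp
  filter_upwards [(Filter.biInter_finset_mem _).2 h] with p hp i hi
  simpa using mem_iInter₂.1 hp i (Finset.mem_range.2 hi)

theorem exists_coordClose_subset {V : Set (HilbertCube × HilbertCube)}
    (hV : V ∈ uniformity HilbertCube) :
    ∃ n : ℕ, ∃ r > 0, ∀ x y : HilbertCube, CoordClose n r x y → (x, y) ∈ V := by
  rw [Pi.uniformity] at hV
  obtain ⟨I, hI, W, hW, -, rfl, -⟩ := Filter.mem_iInf'.1 hV
  clear hV
  induction I, hI using Set.Finite.induction_on with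
  | empty => exact ⟨0, 1, one_pos, by simp⟩
  | @insert i I hi hI ih =>
    obtain ⟨n, r, hr, h⟩ := ih
    obtain ⟨T, hT, hTW⟩ := Filter.mem_comap.1 (hW i)
    obtain ⟨s, hs, hsT⟩ := Metric.mem_uniformity_dist.1 hT
    refine ⟨max n (i + 1), min r (s / 2), by positivity, fun x y hxy => ?_⟩
    rw [biInter_insert]
    refine ⟨hTW (hsT ?_), h x y (hxy.mono (le_max_left _ _) (min_le_left _ _))⟩
    have := hxy i (by simp)
    exact (this.trans (min_le_right _ _)).trans_lt (half_lt_self hs)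

theorem exists_coordClose_of_continuous {f : HilbertCube → HilbertCube} (hf : Continuous f)
    (n : ℕ) {r : ℝ} (hr : 0 < r) :
    ∃ m : ℕ, ∃ s > 0, ∀ x y, CoordClose m s x y → CoordClose n r (f x) (f y) :=
  exists_coordClose_subset (CompactSpace.uniformContinuous_of_continuous hf
    (coordClose_mem_uniformity n hr))

theorem exists_coordClose_notMem {A B : Set HilbertCube} (hA : IsCompact A) (hB : IsClosed B)
    (hAB : Disjoint A B) :
    ∃ n : ℕ, ∃ r > 0, ∀ a ∈ A, ∀ x, CoordClose n r x a → x ∉ B := by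
  obtain ⟨V, hV, h⟩ := hAB.exists_uniform_thickening hA hB
  obtain ⟨n, r, hr, hc⟩ := exists_coordClose_subset hV
  refine ⟨n, r, hr, fun a ha x hx hxB => ?_⟩
  refine disjoint_left.1 h (mem_iUnion₂.2 ⟨a, ha, hc a x hx.symm⟩)
    (mem_iUnion₂.2 ⟨x, hxB, refl_mem_uniformity hV⟩)

theorem Dense.exists_coordClose {U : Set HilbertCube} (hU : Dense U) (x : HilbertCube) (n : ℕ)
    {r : ℝ} (hr : 0 < r) : ∃ y ∈ U, CoordClose n r x y := by
  obtain ⟨y, hy, hyU⟩ := mem_closure_iff_nhds.1 (hU x) _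
    (mem_nhds_left x (coordClose_mem_uniformity n hr))
  exact ⟨y, hyU, hy⟩

/-- The Hilbert cube has a finite cover by open sets that are small in the first coordinates. -/
theorem exists_finite_cover_coordClose (n : ℕ) {r : ℝ} (hr : 0 < r) :
    ∃ U : Set (Set HilbertCube), U.Finite ∧ (∀ V ∈ U, IsOpen V) ∧ ⋃₀ U = Set.univ ∧
      ∀ V ∈ U, ∀ x ∈ V, ∀ y ∈ V, CoordClose n r x y := by
  have hmem (x : HilbertCube) : interior {y | CoordClose n (r / 2) x y} ∈ 𝓝 x :=
    interior_mem_nhds.2 (mem_nhds_left x (coordClose_mem_uniformity n (half_pos hr)))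
  obtain ⟨t, -, ht⟩ := isCompact_univ.elim_nhds_subcover _ fun x _ => hmem x
  refine ⟨(fun x => interior {y | CoordClose n (r / 2) x y}) '' t, t.finite_toSet.image _, ?_, ?_,
    ?_⟩
  · rintro _ ⟨x, -, rfl⟩
    exact isOpen_interior
  · rw [sUnion_image]
    exact Set.univ_subset_iff.1 ht
  · rintro _ ⟨x, -, rfl⟩ y hy z hz
    have h1 : CoordClose n (r / 2) x y := interior_subset hy
    have h2 : CoordClose n (r / 2) x z := interior_subset hz
    simpa using h1.symm.trans h2

theorem IsZSet.exists_coordClose {K : Set HilbertCube} (hK : IsZSet K) (n : ℕ) {r : ℝ}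
    (hr : 0 < r) :
    ∃ f : C(HilbertCube, HilbertCube), (∀ x, f x ∉ K) ∧ ∀ x, CoordClose n r (f x) x := by
  obtain ⟨U, -, hUo, hUc, hU⟩ := exists_finite_cover_coordClose n hr
  obtain ⟨f, hf, hfU⟩ := hK.2 U hUo hUc
  refine ⟨f, hf, fun x => ?_⟩
  obtain ⟨V, hV, hx, hfx⟩ := hfU x
  exact hU V hV _ hfx _ hx

theorem IsZSet.image {X : Type*} [TopologicalSpace X] {K : Set X} (hK : IsZSet K) (h : X ≃ₜ X) :
    IsZSet (h '' K) := by
  refine ⟨h.isClosed_image.2 hK.1, fun U hUo hUc => ?_⟩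
  obtain ⟨f, hf, hfU⟩ := hK.2 ((fun V => h ⁻¹' V) '' U)
    (by rintro _ ⟨V, hV, rfl⟩; exact (hUo V hV).preimage h.continuous)
    (by rw [sUnion_image, ← preimage_iUnion₂, ← sUnion_eq_biUnion, hUc, preimage_univ])
  refine ⟨((h : C(X, X)).comp f).comp (h.symm : C(X, X)), ?_, fun x => ?_⟩
  · rintro x ⟨y, hy, hyx⟩
    exact hf (h.symm x) (h.injective hyx ▸ hy)
  · obtain ⟨_, ⟨V, hV, rfl⟩, hx, hfx⟩ := hfU (h.symm x)
    exact ⟨V, hV, by simpa using hx, hfx⟩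

section Squash

/-- A piecewise linear upper bound for motions of `[0,1]` that fix the endpoints. -/
noncomputable def squashUpper (r d t : ℝ) : ℝ := min 1 (min (t + r) (t / d))

/-- A piecewise linear lower bound for motions of `[0,1]` that fix the endpoints. -/
noncomputable def squashLower (r d t : ℝ) : ℝ := 1 - squashUpper r d (1 - t)

/-- The monotone map of `[0,1]` that moves `t` towards `q` as far as the bounds allow. -/
noncomputable def squashMap (r d e q t : ℝ) : ℝ :=
  (1 - e) * max (squashLower r d t) (min q (squashUpper r d t)) + e * t

theorem continuous_squashMap (r d e : ℝ) :
    Continuous fun p : ℝ × ℝ => squashMap r d e p.1 p.2 := by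
  unfold squashMap squashLower squashUpper
  fun_prop

variable {r d e q t : ℝ}

theorem monotone_squashUpper (hd : 0 < d) : Monotone (squashUpper r d) := fun s t hst => by
  unfold squashUpper
  gcongr

theorem monotone_squashLower (hd : 0 < d) : Monotone (squashLower r d) := fun s t hst => by
  unfold squashLower
  have := monotone_squashUpper (r := r) hd (sub_le_sub_left hst 1)
  linarith

theorem le_squashUpper (hr : 0 ≤ r) (hd : 0 < d) (hd1 : d ≤ 1) (ht : t ∈ Icc (0 : ℝ) 1) :
    t ≤ squashUpper r d t :=
  le_min ht.2 (le_min (by linarith) ((le_div_iff₀ hd).2 (by nlinarith [ht.1])))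

theorem squashLower_le (hr : 0 ≤ r) (hd : 0 < d) (hd1 : d ≤ 1) (ht : t ∈ Icc (0 : ℝ) 1) :
    squashLower r d t ≤ t := by
  have := le_squashUpper hr hd hd1 (t := 1 - t) ⟨by linarith [ht.2], by linarith [ht.1]⟩
  unfold squashLower
  linarith

theorem strictMono_squashMap (hd : 0 < d) (he : 0 < e) (he1 : e ≤ 1) :
    StrictMono (squashMap r d e q) := fun s t hst => by
  have h1 : max (squashLower r d s) (min q (squashUpper r d s)) ≤
      max (squashLower r d t) (min q (squashUpper r d t)) :=
    max_le_max (monotone_squashLower hd hst.le) (min_le_min le_rfl (monotone_squashUpper hd hst.le))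
  have h2 := mul_le_mul_of_nonneg_left h1 (sub_nonneg.2 he1)
  have h3 := mul_lt_mul_of_pos_left hst he
  unfold squashMap
  linarith

theorem squashMap_zero (hr : 0 ≤ r) (hq : 0 ≤ q) (hd : 0 < d) (hd1 : d ≤ 1) :
    squashMap r d e q 0 = 0 := by
  have h1 : squashUpper r d 0 = 0 := by simp [squashUpper, hr]
  have h2 := squashLower_le hr hd hd1 (t := 0) (by simp)
  simp [squashMap, h1, hq, h2]

theorem squashMap_one (hr : 0 ≤ r) (hq : q ≤ 1) :
    squashMap r d e q 1 = 1 := by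
  have h1 : squashLower r d 1 = 1 := by simp [squashLower, squashUpper, hr]
  have : min q (squashUpper r d 1) ≤ 1 := (min_le_left _ _).trans hq
  simp [squashMap, h1, this]

theorem squashMap_mem (hr : 0 ≤ r) (hq : q ∈ Icc (0 : ℝ) 1) (hd : 0 < d) (hd1 : d ≤ 1)
    (he : 0 < e) (he1 : e ≤ 1) (ht : t ∈ Icc (0 : ℝ) 1) : squashMap r d e q t ∈ Icc (0 : ℝ) 1 := by
  have hm := (strictMono_squashMap (r := r) (q := q) hd he he1).monotone
  constructor
  · rw [← squashMap_zero (e := e) hr hq.1 hd hd1]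
    exact hm ht.1
  · rw [← squashMap_one (d := d) (e := e) hr hq.2]
    exact hm ht.2

theorem exists_squashMap_eq (hr : 0 ≤ r) (hq : q ∈ Icc (0 : ℝ) 1) (hd : 0 < d) (hd1 : d ≤ 1)
    (ht : t ∈ Icc (0 : ℝ) 1) : ∃ s ∈ Icc (0 : ℝ) 1, squashMap r d e q s = t := by
  have hc : Continuous (squashMap r d e q) :=
    (continuous_squashMap r d e).comp (Continuous.prodMk_right q)
  have := intermediate_value_Icc zero_le_one hc.continuousOn
  rw [squashMap_zero hr hq.1 hd hd1, squashMap_one hr hq.2] at this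
  exact this ht

theorem abs_squashMap_sub_le (hr : 0 ≤ r) (hd : 0 < d) (hd1 : d ≤ 1) (he : 0 ≤ e) (he1 : e ≤ 1)
    (ht : t ∈ Icc (0 : ℝ) 1) : |squashMap r d e q t - t| ≤ r := by
  set m := max (squashLower r d t) (min q (squashUpper r d t)) with hm
  have hu : squashUpper r d t ≤ t + r := (min_le_right _ _).trans (min_le_left _ _)
  have hl : t - r ≤ squashLower r d t := by
    have : squashUpper r d (1 - t) ≤ 1 - t + r := (min_le_right _ _).trans (min_le_left _ _)
    unfold squashLower
    linarith
  have h1 : m ≤ t + r :=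
    max_le ((squashLower_le hr hd hd1 ht).trans (by linarith)) ((min_le_right _ _).trans hu)
  have h2 : t - r ≤ m := hl.trans (le_max_left _ _)
  have h3 : squashMap r d e q t - t = (1 - e) * (m - t) := by
    unfold squashMap
    ring
  have h4 : |m - t| ≤ r := abs_le.2 ⟨by linarith, by linarith⟩
  rw [h3, abs_mul, abs_of_nonneg (sub_nonneg.2 he1)]
  nlinarith [abs_nonneg (m - t)]

theorem abs_squashMap_sub_target_le (hq : q ∈ Icc (0 : ℝ) 1) (hd : 0 < d) (he : 0 ≤ e)
    (ht : t ∈ Icc d (1 - d)) (htq : |t - q| ≤ r) : |squashMap r d e q t - q| ≤ e := by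
  obtain ⟨h1, h2⟩ := abs_le.1 htq
  have hu : q ≤ squashUpper r d t :=
    le_min hq.2 (le_min (by linarith) (hq.2.trans ((one_le_div hd).2 ht.1)))
  have hl : squashLower r d t ≤ q := by
    have : 1 - q ≤ squashUpper r d (1 - t) :=
      le_min (by linarith [hq.1]) (le_min (by linarith)
        (le_trans (by linarith [hq.1]) ((one_le_div hd).2 (by linarith [ht.2]))))
    unfold squashLower
    linarith
  have h3 : squashMap r d e q t - q = e * (t - q) := by
    unfold squashMap
    rw [min_eq_left hu, max_eq_right hl]
    ring
  have h4 : |t - q| ≤ 1 :=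
    abs_le.2 ⟨by linarith [ht.1, hq.2], by linarith [ht.2, hq.1]⟩
  rw [h3, abs_mul, abs_of_nonneg he]
  nlinarith

end Squash

/-- A homeomorphism of the Hilbert cube changing only the coordinates in `S`, moving the `i`-th
coordinate by at most `r i` and squeezing it to the target `q` wherever that is possible. -/
theorem exists_homeomorph_squash (S : Set ℕ) {q : HilbertCube → HilbertCube} (hq : Continuous q)
    (hqS : ∀ x y : HilbertCube, (∀ i ∉ S, x i = y i) → q x = q y) {r : ℕ → ℝ} (hr : ∀ i, 0 ≤ r i)
    {d e : ℝ} (hd : 0 < d) (he : 0 < e) :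
    ∃ h : HilbertCube ≃ₜ HilbertCube, (∀ x, ∀ i ∉ S, h x i = x i) ∧
      (∀ x i, |(h x i : ℝ) - x i| ≤ r i) ∧
      ∀ x, ∀ i ∈ S, (x i : ℝ) ∈ Icc d (1 - d) → |(x i : ℝ) - q x i| ≤ r i →
        |(h x i : ℝ) - q x i| ≤ e := by
  classical
  wlog hd1 : d ≤ 1 generalizing d
  · obtain ⟨h, h1, h2, -⟩ := this one_pos le_rfl
    exact ⟨h, h1, h2, fun x i _ hx => by linarith [hx.1, hx.2]⟩
  wlog he1 : e ≤ 1 generalizing e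
  · obtain ⟨h, h1, h2, h3⟩ := this one_pos le_rfl
    exact ⟨h, h1, h2, fun x i hi hx hxq => (h3 x i hi hx hxq).trans (by linarith)⟩
  let f : HilbertCube → HilbertCube := fun x i =>
    if i ∈ S then ⟨squashMap (r i) d e (q x i) (x i),
      squashMap_mem (hr i) (q x i).2 hd hd1 he he1 (x i).2⟩ else x i
  have hfS (x : HilbertCube) (i : ℕ) (hi : i ∈ S) :
      (f x i : ℝ) = squashMap (r i) d e (q x i) (x i) := by simp [f, hi]
  have hfS' (x : HilbertCube) (i : ℕ) (hi : i ∉ S) : f x i = x i := by simp [f, hi]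
  have hfc : Continuous f := by
    refine continuous_pi fun i => ?_
    by_cases hi : i ∈ S
    · simp only [f, hi, if_true]
      refine Continuous.subtype_mk ((continuous_squashMap (r i) d e).comp (Continuous.prodMk ?_ ?_)) _
      · exact continuous_subtype_val.comp ((continuous_apply i).comp hq)
      · exact continuous_subtype_val.comp (continuous_apply i)
    · simp only [f, hi, if_false]
      exact continuous_apply i
  have hfi : Function.Injective f := by
    intro x y hxy
    have hS : ∀ i ∉ S, x i = y i := fun i hi => by
      rw [← hfS' x i hi, ← hfS' y i hi, hxy]
    funext i
    by_cases hi : i ∈ S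
    · refine Subtype.ext ((strictMono_squashMap (r := r i) (q := q x i) hd he he1).injective ?_)
      rw [← hfS x i hi, hxy, hfS y i hi, hqS x y hS]
    · exact hS i hi
  have hfs : Function.Surjective f := by
    intro y
    choose g hg hgy using fun i =>
      exists_squashMap_eq (e := e) (hr i) (q y i).2 hd hd1 (y i).2
    let x : HilbertCube := fun i => if i ∈ S then ⟨g i, hg i⟩ else y i
    have hx : q x = q y := hqS x y fun i hi => by simp [x, hi]
    refine ⟨x, funext fun i => Subtype.ext ?_⟩
    by_cases hi : i ∈ S
    · rw [hfS x i hi, hx, ← hgy i]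
      simp [x, hi]
    · rw [hfS' x i hi]
      simp [x, hi]
  let h := Continuous.homeoOfEquivCompactToT2 (f := Equiv.ofBijective f ⟨hfi, hfs⟩) hfc
  have hh (x : HilbertCube) : h x = f x := rfl
  refine ⟨h, fun x i hi => by rw [hh, hfS' x i hi], fun x i => ?_, fun x i hi hx hxq => ?_⟩
  · by_cases hi : i ∈ S
    · rw [hh, hfS x i hi]
      exact abs_squashMap_sub_le (hr i) hd hd1 he.le he1 (x i).2
    · rw [hh, hfS' x i hi]
      simpa using hr i
  · rw [hh, hfS x i hi]
    exact abs_squashMap_sub_target_le (q x i).2 hd he.le hx hxq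

/-- Klee's graph trick: a self-map of the Hilbert cube that is near the identity on `C` is
approximated on `C` by a homeomorphism near the identity, provided sufficiently many coordinates
stay away from `0` and `1` on `C`. -/
theorem exists_homeomorph_approx (f : C(HilbertCube, HilbertCube)) {N n : ℕ} (hN : N ≤ n)
    {r e : ℝ} (hr : 0 < r) (he : 0 < e) :
    ∃ M : ℕ, ∀ d > 0, ∀ C : Set HilbertCube,
      (∀ x ∈ C, ∀ i < M, (x i : ℝ) ∈ Icc d (1 - d)) → (∀ x ∈ C, CoordClose N r (f x) x) →
      ∃ h : HilbertCube ≃ₜ HilbertCube, (∀ x, CoordClose N (2 * r) (h x) x) ∧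
        ∀ x ∈ C, CoordClose n e (h x) (f x) := by
  wlog her : e ≤ r generalizing e
  · obtain ⟨M, hM⟩ := this hr le_rfl
    refine ⟨M, fun d hd C hC hfC => ?_⟩
    obtain ⟨h, h1, h2⟩ := hM d hd C hC hfC
    exact ⟨h, h1, fun x hx => (h2 x hx).mono le_rfl (by linarith)⟩
  obtain ⟨m, s, hs, hm⟩ := exists_coordClose_of_continuous f.continuous n (half_pos he)
  set k := max n m with hk
  have hnk : n ≤ k := le_max_left _ _
  refine ⟨2 * k, fun d hd C hC hfC => ?_⟩
  let q₁ : HilbertCube → HilbertCube := fun x i => if i ∈ Ico k (2 * k) then x (i - k) else 0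
  have hq₁ : Continuous q₁ := continuous_pi fun i => by
    by_cases hi : i ∈ Ico k (2 * k)
    · simp only [q₁, hi, if_true]; fun_prop
    · simp only [q₁, hi, if_false]; fun_prop
  obtain ⟨h₁, h₁S, h₁r, h₁q⟩ := exists_homeomorph_squash (Ico k (2 * k)) hq₁
    (fun x y hxy => funext fun i => by
      by_cases hi : i ∈ Ico k (2 * k)
      · simp only [q₁, hi, if_true]
        exact hxy _ (by simp only [mem_Ico] at hi ⊢; omega)
      · simp only [q₁, hi, if_false]) (r := fun _ => 1) (fun _ => zero_le_one) hd hs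
  let shift : HilbertCube → HilbertCube := fun x i => x (i + k)
  obtain ⟨h₂, -, h₂r, h₂q⟩ := exists_homeomorph_squash (Iio k)
    (q := fun x => f (shift x)) (f.continuous.comp (by fun_prop))
    (fun x y hxy => by
      have : shift x = shift y := funext fun i => hxy _ (by simp)
      simp only [this]) (r := fun i => if i < N then 2 * r else 1)
    (fun i => by split_ifs <;> positivity) hd (half_pos he)
  refine ⟨h₁.trans h₂, fun x i hi => ?_, fun x hx i hi => ?_⟩
  · have := h₂r (h₁ x) i
    rwa [if_pos hi, h₁S x i (by simp only [mem_Ico]; omega)] at this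
  · have hsh : CoordClose m s (shift (h₁ x)) x := fun j hj => by
      have hj' : j + k ∈ Ico k (2 * k) := by
        have : m ≤ k := le_max_right _ _
        simp only [mem_Ico]; omega
      have := h₁q x (j + k) hj' (hC x hx _ hj'.2)
      simp only [q₁, hj', if_true, Nat.add_sub_cancel] at this
      refine this (abs_le.2 ⟨?_, ?_⟩) <;>
        linarith [(x (j + k)).2.1, (x (j + k)).2.2, (x j).2.1, (x j).2.2]
    have hf := hm _ _ hsh
    have hx₁ : h₁ x i = x i := h₁S x i (by simp only [mem_Ico]; omega)
    have := h₂q (h₁ x) i (hi.trans_le hnk) (by rw [hx₁]; exact hC x hx i (by omega)) (by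
      rw [hx₁]
      split_ifs with hiN
      · have h1 := hf i hi
        have h2 := hfC x hx i hiN
        rw [abs_le] at *
        constructor <;> linarith
      · exact abs_le.2 ⟨by linarith [(x i).2.1, (f (shift (h₁ x)) i).2.2],
          by linarith [(x i).2.2, (f (shift (h₁ x)) i).2.1]⟩)
    have h1 := hf i hi
    calc |((h₁.trans h₂) x i : ℝ) - f x i|
        ≤ |(h₂ (h₁ x) i : ℝ) - f (shift (h₁ x)) i| + |(f (shift (h₁ x)) i : ℝ) - f x i| :=
          abs_sub_le _ _ _
      _ ≤ e := by linarith

section Slide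

/-- Sliding of the boundary coordinate `t` around a corner, at distance `1 - r` from it. -/
noncomputable def slide (r t : ℝ) : ℝ := max t (min (3 * t + 2 * r) ((t + 2 * r) / 3))

/-- The inverse of `slide r`. -/
noncomputable def slideInv (r t : ℝ) : ℝ := min t (max ((t - 2 * r) / 3) (3 * t - 2 * r))

theorem slideInv_slide (r t : ℝ) : slideInv r (slide r t) = t := by
  unfold slideInv slide
  grind

theorem slide_slideInv (r t : ℝ) : slide r (slideInv r t) = t := by
  unfold slideInv slide
  grind

/-- The plane map acting by `φ` on the boundary coordinate `a - b` of a quadrant, keeping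
`min a b`. -/
noncomputable def cornerMap (φ : ℝ → ℝ → ℝ) (p : ℝ × ℝ) : ℝ × ℝ :=
  (min p.1 p.2 + max (φ (1 - min p.1 p.2) (p.1 - p.2)) 0,
    min p.1 p.2 + max (-φ (1 - min p.1 p.2) (p.1 - p.2)) 0)

theorem cornerMap_cornerMap {φ ψ : ℝ → ℝ → ℝ} (h : ∀ r t, ψ r (φ r t) = t) (p : ℝ × ℝ) :
    cornerMap ψ (cornerMap φ p) = p := by
  set s := min p.1 p.2 with hs
  set t := φ (1 - s) (p.1 - p.2) with ht
  have h1 : min (cornerMap φ p).1 (cornerMap φ p).2 = s := by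
    simp only [cornerMap, ← hs, ← ht]
    grind
  have h2 : (cornerMap φ p).1 - (cornerMap φ p).2 = t := by
    simp only [cornerMap, ← hs, ← ht]
    grind
  rw [cornerMap, h1, h2, ht, h]
  ext <;> simp only [hs] <;> grind

theorem continuous_cornerMap_slide : Continuous (cornerMap slide) := by
  unfold cornerMap slide
  fun_prop

theorem continuous_cornerMap_slideInv : Continuous (cornerMap slideInv) := by
  unfold cornerMap slideInv
  fun_prop

theorem cornerMap_slide_mem {L : ℝ} (hL : 1 ≤ L) {p : ℝ × ℝ} (h : p ∈ Icc 0 L ×ˢ Icc (0 : ℝ) 1) :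
    cornerMap slide p ∈ Icc 0 L ×ˢ Icc (0 : ℝ) 1 := by
  obtain ⟨⟨h1, h2⟩, h3, h4⟩ := h
  simp only [cornerMap, slide, mem_prod, mem_Icc]
  grind

theorem cornerMap_slideInv_mem {L : ℝ} {p : ℝ × ℝ} (h : p ∈ Icc 0 L ×ˢ Icc (0 : ℝ) 1) :
    cornerMap slideInv p ∈ Icc 0 L ×ˢ Icc (0 : ℝ) 1 := by
  obtain ⟨⟨h1, h2⟩, h3, h4⟩ := h
  simp only [cornerMap, slideInv, mem_prod, mem_Icc]
  grind

theorem abs_cornerMap_slide_sub_le {p : ℝ × ℝ} (h1 : 0 ≤ p.1) (h3 : 0 ≤ p.2) (h4 : p.2 ≤ 1) :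
    |(cornerMap slide p).1 - p.1| ≤ 1 := by
  simp only [cornerMap, slide, abs_le]
  grind

theorem cornerMap_slide_top {p : ℝ × ℝ} (h1 : 0 ≤ p.1) (h2 : p.2 = 0) :
    (cornerMap slide p).2 = 0 ∧ 2 / 3 ≤ (cornerMap slide p).1 ∧
      (cornerMap slide p).1 ≤ max p.1 1 := by
  simp only [cornerMap, slide]
  grind

theorem cornerMap_slide_left {p : ℝ × ℝ} (h1 : p.1 = 0) (h2 : 0 ≤ p.2) (h3 : p.2 ≤ 1 / 3) :
    (cornerMap slide p).2 = 0 ∧ 1 / 3 ≤ (cornerMap slide p).1 ∧ (cornerMap slide p).1 ≤ 1 := by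
  simp only [cornerMap, slide]
  grind

theorem cornerMap_slideInv_left {p : ℝ × ℝ} (h1 : p.1 = 0) (h2 : 0 ≤ p.2) :
    (cornerMap slideInv p).1 = 0 ∧ 2 / 3 ≤ (cornerMap slideInv p).2 := by
  simp only [cornerMap, slideInv]
  grind

end Slide

section Square

/-- The unit square. -/
abbrev UnitSquare : Type := ↥(Icc (0 : ℝ) 1) × ↥(Icc (0 : ℝ) 1)

/-- The reflection `t ↦ 1 - t` of the unit interval. -/
def flipInterval : ↥(Icc (0 : ℝ) 1) ≃ₜ ↥(Icc (0 : ℝ) 1) where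
  toFun t := ⟨1 - t, by linarith [t.2.2], by linarith [t.2.1]⟩
  invFun t := ⟨1 - t, by linarith [t.2.2], by linarith [t.2.1]⟩
  left_inv t := by simp
  right_inv t := by simp

@[simp]
theorem coe_flipInterval (t : ↥(Icc (0 : ℝ) 1)) : (flipInterval t : ℝ) = 1 - t := rfl

@[simp]
theorem coe_flipInterval_symm (t : ↥(Icc (0 : ℝ) 1)) : (flipInterval.symm t : ℝ) = 1 - t := rfl

/-- Sliding the boundary of the unit square from the left edge to the top edge, through a motion
of size at most `e` in the first coordinate. -/
theorem exists_homeomorph_slide {e : ℝ} (he : 0 < e) (he1 : e ≤ 1) :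
    ∃ β : UnitSquare ≃ₜ UnitSquare, (∀ p, |((β p).1 : ℝ) - p.1| ≤ e) ∧
      (∀ p, (p.2 : ℝ) = 1 → ((β p).2 : ℝ) = 1 ∧ 2 * e / 3 ≤ (β p).1 ∧ (β p).1 ≤ max (p.1 : ℝ) e) ∧
      (∀ p, (p.1 : ℝ) = 0 → 2 / 3 ≤ (p.2 : ℝ) →
        ((β p).2 : ℝ) = 1 ∧ e / 3 ≤ (β p).1 ∧ ((β p).1 : ℝ) ≤ e) ∧
      ∀ p, (p.1 : ℝ) = 0 → ((β.symm p).1 : ℝ) = 0 ∧ ((β.symm p).2 : ℝ) ≤ 1 / 3 := by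
  have hL : 1 ≤ 1 / e := (one_le_div he).2 he1
  let u : UnitSquare → ℝ × ℝ := fun p => (p.1 / e, 1 - p.2)
  have hu (p : UnitSquare) : u p ∈ Icc 0 (1 / e) ×ˢ Icc (0 : ℝ) 1 :=
    ⟨⟨div_nonneg p.1.2.1 he.le, by dsimp only [u]; gcongr; exact p.1.2.2⟩,
      by dsimp only [u]; linarith [p.2.2.2], by dsimp only [u]; linarith [p.2.2.1]⟩
  have hv {p : ℝ × ℝ} (hp : p ∈ Icc 0 (1 / e) ×ˢ Icc (0 : ℝ) 1) :
      e * p.1 ∈ Icc (0 : ℝ) 1 ∧ 1 - p.2 ∈ Icc (0 : ℝ) 1 := by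
    obtain ⟨⟨h1, h2⟩, h3, h4⟩ := hp
    refine ⟨⟨by positivity, ?_⟩, by linarith, by linarith⟩
    rwa [le_div_iff₀' he] at h2
  let v : ∀ p : ℝ × ℝ, p ∈ Icc 0 (1 / e) ×ˢ Icc (0 : ℝ) 1 → UnitSquare := fun p hp =>
    (⟨e * p.1, (hv hp).1⟩, ⟨1 - p.2, (hv hp).2⟩)
  have huv (p : ℝ × ℝ) (hp) : u (v p hp) = p := by
    ext <;> simp [u, v, he.ne']
  have hvu (p : UnitSquare) (q : ℝ × ℝ) (hq) (h : q = u p) : v q hq = p := by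
    subst h
    ext
    · simp only [u, v]; field_simp
    · simp only [u, v]; ring
  have huc : Continuous u := by fun_prop
  let β : UnitSquare ≃ₜ UnitSquare :=
    { toFun := fun p => v (cornerMap slide (u p)) (cornerMap_slide_mem hL (hu p))
      invFun := fun p => v (cornerMap slideInv (u p)) (cornerMap_slideInv_mem (hu p))
      left_inv := fun p => hvu _ _ (cornerMap_slideInv_mem (hu _)) (by
        rw [huv (cornerMap slide (u p)) (cornerMap_slide_mem hL (hu p)),
          cornerMap_cornerMap slideInv_slide])
      right_inv := fun p => hvu _ _ (cornerMap_slide_mem hL (hu _)) (by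
        rw [huv (cornerMap slideInv (u p)) (cornerMap_slideInv_mem (hu p)),
          cornerMap_cornerMap slide_slideInv])
      continuous_toFun := by
        have := continuous_cornerMap_slide.comp huc
        refine Continuous.prodMk (Continuous.subtype_mk ?_ _) (Continuous.subtype_mk ?_ _)
        · exact continuous_const.mul (continuous_fst.comp this)
        · exact continuous_const.sub (continuous_snd.comp this)
      continuous_invFun := by
        have := continuous_cornerMap_slideInv.comp huc
        refine Continuous.prodMk (Continuous.subtype_mk ?_ _) (Continuous.subtype_mk ?_ _)
        · exact continuous_const.mul (continuous_fst.comp this)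
        · exact continuous_const.sub (continuous_snd.comp this) }
  have hβ1 (p) : ((β p).1 : ℝ) = e * (cornerMap slide (u p)).1 := rfl
  have hβ2 (p) : ((β p).2 : ℝ) = 1 - (cornerMap slide (u p)).2 := rfl
  have hβ1' (p) : ((β.symm p).1 : ℝ) = e * (cornerMap slideInv (u p)).1 := rfl
  have hβ2' (p) : ((β.symm p).2 : ℝ) = 1 - (cornerMap slideInv (u p)).2 := rfl
  have hu1 (p) : (p.1 : ℝ) = e * (u p).1 := by simp only [u]; field_simp
  have hu2 (p) : (u p).2 = 1 - p.2 := rfl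
  refine ⟨β, fun p => ?_, fun p hp => ?_, fun p hp hp' => ?_, fun p hp => ?_⟩
  · have := abs_cornerMap_slide_sub_le (hu p).1.1 (hu p).2.1 (hu p).2.2
    rw [hβ1, hu1, ← mul_sub, abs_mul, abs_of_pos he]
    nlinarith
  · obtain ⟨h1, h2, h3⟩ := cornerMap_slide_top (hu p).1.1 (by rw [hu2, hp, sub_self])
    rw [hβ1, hβ2, hu1 p, h1]
    refine ⟨sub_zero _, by nlinarith, ?_⟩
    have := mul_le_mul_of_nonneg_left h3 he.le
    rwa [mul_max_of_nonneg _ _ he.le, mul_one] at this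
  · obtain ⟨h1, h2, h3⟩ := cornerMap_slide_left (p := u p) (by simp [u, hp]) (hu p).2.1
      (by rw [hu2]; linarith)
    rw [hβ1, hβ2, h1]
    exact ⟨sub_zero _, by nlinarith, by nlinarith⟩
  · obtain ⟨h1, h2⟩ := cornerMap_slideInv_left (p := u p) (by simp [u, hp]) (hu p).2.1
    rw [hβ1', hβ2', h1]
    exact ⟨mul_zero _, by linarith⟩

/-- A homeomorphism of the square, near the identity in the first coordinate, that moves the top
edge into the interior of the top edge. -/
theorem exists_homeomorph_shrink_top {e : ℝ} (he : 0 < e) :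
    ∃ β : UnitSquare ≃ₜ UnitSquare, (∀ p, |((β p).1 : ℝ) - p.1| ≤ e) ∧
      ∃ d > 0, ∀ p, (p.2 : ℝ) = 1 → ((β p).2 : ℝ) = 1 ∧ ((β p).1 : ℝ) ∈ Icc d (1 - d) := by
  set e' := min (e / 2) (1 / 4) with he'
  have h0 : 0 < e' := by positivity
  have h1 : e' ≤ e / 2 := min_le_left _ _
  have h2 : e' ≤ 1 / 4 := min_le_right _ _
  obtain ⟨β, hβ, hβt, -⟩ := exists_homeomorph_slide h0 (by linarith)
  let φ := flipInterval.prodCongr (Homeomorph.refl ↥(Icc (0 : ℝ) 1))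
  refine ⟨(β.trans φ).trans (β.trans φ.symm), fun p => ?_, 2 * e' / 3, by positivity,
    fun p hp => ?_⟩
  · have ha := hβ p
    have hb := hβ (φ (β p))
    simp [φ] at hb ⊢
    rw [abs_le] at *
    constructor <;> linarith
  · obtain ⟨ha1, ha2, ha3⟩ := hβt p hp
    obtain ⟨hb1, hb2, hb3⟩ := hβt (φ (β p)) (by simpa [φ] using ha1)
    simp [φ] at hb1 hb2 hb3 ⊢
    refine ⟨hb1, ?_, by linarith⟩
    rcases hb3 with hb3 | hb3 <;> linarith

/-- A homeomorphism of the square, near the identity in the first coordinate, that moves the left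
edge into the interior of the top edge. -/
theorem exists_homeomorph_left_to_top {e : ℝ} (he : 0 < e) :
    ∃ β : UnitSquare ≃ₜ UnitSquare, (∀ p, |((β p).1 : ℝ) - p.1| ≤ e) ∧
      ∃ d > 0, ∀ p, (p.1 : ℝ) = 0 → ((β p).2 : ℝ) = 1 ∧ ((β p).1 : ℝ) ∈ Icc d (1 - d) := by
  set e' := min (e / 2) (1 / 4) with he'
  have h0 : 0 < e' := by positivity
  have h1 : e' ≤ e / 2 := min_le_left _ _
  have h2 : e' ≤ 1 / 4 := min_le_right _ _
  obtain ⟨β, hβ, -, hβl, hβs⟩ := exists_homeomorph_slide h0 (by linarith)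
  let φ := (Homeomorph.refl ↥(Icc (0 : ℝ) 1)).prodCongr flipInterval
  refine ⟨(φ.trans β.symm).trans (φ.symm.trans β), fun p => ?_, e' / 3, by positivity,
    fun p hp => ?_⟩
  · have ha := hβ (β.symm (φ p))
    have hb := hβ (φ.symm (β.symm (φ p)))
    simp [φ] at ha hb ⊢
    rw [abs_le] at *
    constructor <;> linarith
  · obtain ⟨ha1, ha2⟩ := hβs (φ p) (by simpa [φ] using hp)
    obtain ⟨hb1, hb2, hb3⟩ := hβl (φ.symm (β.symm (φ p))) (by simpa [φ] using ha1)
      (by simp [φ] at ha2 ⊢; linarith)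
    exact ⟨hb1, hb2, hb3.trans (by linarith)⟩

/-- A homeomorphism of the square acting on two coordinates of the Hilbert cube. -/
def squareHomeomorph (β : UnitSquare ≃ₜ UnitSquare) {i j : ℕ} (hij : i ≠ j) :
    HilbertCube ≃ₜ HilbertCube where
  toFun x k := if k = i then (β (x i, x j)).1 else if k = j then (β (x i, x j)).2 else x k
  invFun x k :=
    if k = i then (β.symm (x i, x j)).1 else if k = j then (β.symm (x i, x j)).2 else x k
  left_inv x := by
    funext k
    by_cases hi : k = i
    · simp [hi, hij.symm]
    · by_cases hj : k = j
      · simp [hj, hij.symm]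
      · simp [hi, hj]
  right_inv x := by
    funext k
    by_cases hi : k = i
    · simp [hi, hij.symm]
    · by_cases hj : k = j
      · simp [hj, hij.symm]
      · simp [hi, hj]
  continuous_toFun := continuous_pi fun k => by
    split_ifs <;> fun_prop
  continuous_invFun := continuous_pi fun k => by
    split_ifs <;> fun_prop

variable (β : UnitSquare ≃ₜ UnitSquare) {i j : ℕ} (hij : i ≠ j) (x : HilbertCube)

theorem squareHomeomorph_apply_fst : squareHomeomorph β hij x i = (β (x i, x j)).1 := by
  simp [squareHomeomorph]

theorem squareHomeomorph_apply_snd : squareHomeomorph β hij x j = (β (x i, x j)).2 := by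
  simp [squareHomeomorph, hij.symm]

theorem squareHomeomorph_apply_of_ne {k : ℕ} (hi : k ≠ i) (hj : k ≠ j) :
    squareHomeomorph β hij x k = x k := by
  simp [squareHomeomorph, hi, hj]

end Square

/-- A homeomorphism of the square, near the identity in the first coordinate, that moves a vertical
edge into the interior of the top edge. -/
theorem exists_homeomorph_edge_to_top {θ : ℝ} (hθ : θ = 0 ∨ θ = 1) {e : ℝ} (he : 0 < e) :
    ∃ β : UnitSquare ≃ₜ UnitSquare, (∀ p, |((β p).1 : ℝ) - p.1| ≤ e) ∧
      ∃ d > 0, ∀ p, (p.1 : ℝ) = θ → ((β p).2 : ℝ) = 1 ∧ ((β p).1 : ℝ) ∈ Icc d (1 - d) := by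
  obtain ⟨β, hβ, d, hd, hβd⟩ := exists_homeomorph_left_to_top he
  rcases hθ with rfl | rfl
  · exact ⟨β, hβ, d, hd, hβd⟩
  let φ := flipInterval.prodCongr (Homeomorph.refl ↥(Icc (0 : ℝ) 1))
  have hφ (p : UnitSquare) : ((φ p).1 : ℝ) = 1 - p.1 := rfl
  refine ⟨(φ.trans β).trans φ, fun p => ?_, d, hd, fun p hp => ?_⟩
  · have h := hβ (φ p)
    simp only [Homeomorph.trans_apply, hφ] at h ⊢
    rw [abs_le] at *
    constructor <;> linarith
  · obtain ⟨h1, h2, h3⟩ := hβd (φ p) (by simp [φ, hp])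
    refine ⟨h1, ?_⟩
    simp only [Homeomorph.trans_apply, hφ, mem_Icc]
    constructor <;> linarith

/-- A face of the Hilbert cube can be moved, by a homeomorphism near the identity, off all faces
of the first `M` coordinates. -/
theorem exists_homeomorph_face {θ : ℝ} (hθ : θ = 0 ∨ θ = 1) {c M : ℕ} (hc : c < M) {e : ℝ}
    (he : 0 < e) :
    ∃ φ : HilbertCube ≃ₜ HilbertCube, (∀ x, CoordClose M e (φ x) x) ∧
      ∃ d > 0, ∀ x : HilbertCube, (x c : ℝ) = θ → ∀ i < M, (φ x i : ℝ) ∈ Icc d (1 - d) := by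
  suffices H : ∀ s ⊆ (Finset.range M).erase c, ∀ e > 0,
      ∃ φ : HilbertCube ≃ₜ HilbertCube, (∀ x, CoordClose M e (φ x) x) ∧
        ∃ d > 0, ∀ x : HilbertCube, (x c : ℝ) = θ → (φ x M : ℝ) = 1 ∧
          ∀ i ∈ insert c s, (φ x i : ℝ) ∈ Icc d (1 - d) by
    obtain ⟨φ, hφ, d, hd, h⟩ := H _ subset_rfl e he
    refine ⟨φ, hφ, d, hd, fun x hx i hi => (h x hx).2 i ?_⟩
    by_cases hic : i = c <;> simp [hic, hi]
  intro s
  induction s using Finset.induction_on with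
  | empty =>
    intro _ e he
    obtain ⟨β, hβ, d, hd, hβd⟩ := exists_homeomorph_edge_to_top hθ he
    refine ⟨squareHomeomorph β hc.ne, fun x i hi => ?_, d, hd, fun x hx => ⟨?_, fun i hi => ?_⟩⟩
    · by_cases hic : i = c
      · rw [hic, squareHomeomorph_apply_fst]
        exact hβ (x c, x M)
      · rw [squareHomeomorph_apply_of_ne _ _ _ hic hi.ne, sub_self, abs_zero]
        exact he.le
    · rw [squareHomeomorph_apply_snd]
      exact (hβd (x c, x M) hx).1
    · obtain rfl : i = c := by simpa using hi
      rw [squareHomeomorph_apply_fst]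
      exact (hβd (x i, x M) hx).2
  | insert j s hj ih =>
    intro hs e he
    have hjM : j < M := by simpa using Finset.mem_of_mem_erase (hs (Finset.mem_insert_self j s))
    have hjc : j ≠ c := Finset.ne_of_mem_erase (hs (Finset.mem_insert_self j s))
    have hsM := (Finset.subset_insert j s).trans hs
    obtain ⟨φ, hφ, d, hd, hφd⟩ := ih hsM (e / 2) (half_pos he)
    obtain ⟨β, hβ, d', hd', hβd⟩ := exists_homeomorph_shrink_top (half_pos he)
    refine ⟨φ.trans (squareHomeomorph β hjM.ne), fun x => ?_, min d d', lt_min hd hd',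
      fun x hx => ?_⟩
    · refine (CoordClose.trans (y := φ x) (fun i hi => ?_) (hφ x)).mono le_rfl (add_halves e).le
      rw [Homeomorph.trans_apply]
      by_cases hij : i = j
      · rw [hij, squareHomeomorph_apply_fst]
        exact hβ _
      · rw [squareHomeomorph_apply_of_ne _ _ _ hij hi.ne, sub_self, abs_zero]
        exact (half_pos he).le
    · obtain ⟨h1, h2⟩ := hφd x hx
      obtain ⟨h3, h4⟩ := hβd (φ x j, φ x M) h1
      rw [Homeomorph.trans_apply, squareHomeomorph_apply_snd]
      refine ⟨h3, fun i hi => ?_⟩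
      by_cases hij : i = j
      · rw [hij, squareHomeomorph_apply_fst]
        exact Icc_subset_Icc (min_le_right _ _) (by linarith [min_le_right d d']) h4
      · have his : i ∈ insert c s := by
          simp only [Finset.mem_insert] at hi ⊢
          tauto
        have hiM : i ≠ M := by
          rcases Finset.mem_insert.1 his with h | h
          · omega
          · have := Finset.mem_range.1 (Finset.mem_of_mem_erase (hsM h))
            omega
        rw [squareHomeomorph_apply_of_ne _ _ _ hij hiM]
        exact Icc_subset_Icc (min_le_left _ _) (by linarith [min_le_left d d']) (h2 i his)

/-- A Z-set can be moved off a face by a homeomorphism near the identity. -/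
theorem IsZSet.exists_homeomorph_ne {K : Set HilbertCube} (hK : IsZSet K) {θ : ℝ}
    (hθ : θ = 0 ∨ θ = 1) (c N : ℕ) {e : ℝ} (he : 0 < e) :
    ∃ h : HilbertCube ≃ₜ HilbertCube, (∀ x, CoordClose N e (h x) x) ∧
      ∀ x ∈ K, (h x c : ℝ) ≠ θ := by
  have he4 : 0 < e / 4 := by positivity
  obtain ⟨f, hfK, hf⟩ := hK.exists_coordClose N he4
  obtain ⟨n, r, hr, hn⟩ := exists_coordClose_notMem (isCompact_range f.continuous) hK.1
    (disjoint_left.2 (by rintro _ ⟨x, rfl⟩; exact hfK x))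
  obtain ⟨M, hM⟩ := exists_homeomorph_approx f (le_max_left N n) he4 hr
  obtain ⟨φ, hφ, d, hd, hφd⟩ := exists_homeomorph_face hθ (c := c) (M := max M (max N (c + 1)))
    (by omega) he4
  obtain ⟨h, hh, hhf⟩ := hM d hd (φ '' {x | (x c : ℝ) = θ})
    (by
      rintro _ ⟨x, hx, rfl⟩ i hi
      exact hφd x hx i (by omega))
    (fun x _ => hf x)
  refine ⟨(φ.trans h).symm, fun x => ?_, fun x hx hxc => ?_⟩
  · have h1 := hh (φ ((φ.trans h).symm x))
    have h2 := hφ ((φ.trans h).symm x)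
    rw [← Homeomorph.trans_apply, Homeomorph.apply_symm_apply] at h1
    exact (h1.trans (h2.mono (m := N) (by omega) le_rfl)).symm.mono le_rfl (by linarith)
  · have h1 := (hhf _ ⟨(φ.trans h).symm x, hxc, rfl⟩).mono (le_max_right N n) le_rfl
    rw [← Homeomorph.trans_apply, Homeomorph.apply_symm_apply] at h1
    exact hn _ (mem_range_self _) _ h1 hx

/-- A Z-set can be moved, by a homeomorphism near the identity, off all faces of the first `M`
coordinates. -/
theorem IsZSet.exists_homeomorph_mem_Icc {K : Set HilbertCube} (hK : IsZSet K) (M N : ℕ) {e : ℝ}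
    (he : 0 < e) :
    ∃ h : HilbertCube ≃ₜ HilbertCube, (∀ x, CoordClose N e (h x) x) ∧
      ∃ d > 0, ∀ x ∈ K, ∀ i < M, (h x i : ℝ) ∈ Icc d (1 - d) := by
  have key : ∀ (K : Set HilbertCube), IsZSet K → ∀ (θ : ℝ), θ = 0 ∨ θ = 1 → ∀ (c N : ℕ) (e : ℝ),
      0 < e → ∃ h : HilbertCube ≃ₜ HilbertCube, (∀ x, CoordClose N e (h x) x) ∧
        ∃ d > 0, ∀ x ∈ K, d ≤ |(h x c : ℝ) - θ| := by
    intro K hK θ hθ c N e he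
    obtain ⟨h, hh, hne⟩ := hK.exists_homeomorph_ne hθ c N he
    refine ⟨h, hh, ?_⟩
    obtain rfl | hKne := K.eq_empty_or_nonempty
    · exact ⟨1, one_pos, by simp⟩
    obtain ⟨y, hy, hmin⟩ := hK.1.isCompact.exists_isMinOn hKne
      (f := fun x => |(h x c : ℝ) - θ|) (by fun_prop)
    exact ⟨_, abs_pos.2 (sub_ne_zero.2 (hne y hy)), fun x hx => hmin hx⟩
  induction M generalizing N e with
  | zero => exact ⟨Homeomorph.refl _, fun x i _ => by simpa using he.le, 1, one_pos, by simp⟩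
  | succ M ih =>
    obtain ⟨h, hh, d, hd, hhd⟩ := ih (max N (M + 1)) (e := e / 4) (by positivity)
    obtain ⟨g, hg, d', hd', hgd⟩ := key _ (hK.image h) 0 (.inl rfl) M (max N (M + 1))
      (min (e / 4) (d / 4)) (by positivity)
    obtain ⟨k, hk, d'', hd'', hkd⟩ := key _ ((hK.image h).image g) 1 (.inr rfl) M (max N (M + 1))
      (min (e / 4) (min (d / 4) (d' / 4))) (by positivity)
    refine ⟨(h.trans g).trans k, fun x => ?_, min (d / 4) (min (d' / 4) d''), by positivity,
      fun x hx i hi => ?_⟩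
    · refine (((hk (g (h x))).trans (hg (h x))).trans (hh x)).mono (le_max_left _ _) ?_
      have := min_le_left (e / 4) (min (d / 4) (d' / 4))
      have := min_le_left (e / 4) (d / 4)
      linarith
    · have h1 := hg (h x) i (by omega)
      have h2 := hk (g (h x)) i (by omega)
      have h3 : i < M → _ := fun hi => hhd x hx i hi
      have h4 := hgd _ (mem_image_of_mem _ hx)
      have h5 := hkd _ (mem_image_of_mem _ (mem_image_of_mem _ hx))
      have h6 := (k (g (h x)) i).2.1
      have h7 := (k (g (h x)) i).2.2
      have h8 := (g (h x) i).2.1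
      simp only [Homeomorph.trans_apply, mem_Icc] at h3 ⊢
      rcases Nat.lt_succ_iff_lt_or_eq.1 hi with hi | rfl
      · have := h3 hi
        clear h3 h4 h5
        grind
      · clear h3
        grind

/-- Finitely many constants on disjoint closed sets extend to a continuous map. -/
theorem exists_continuousMap_eq_on_closed.{u, v} {X : Type u} {Y : Type v} {J : Type*}
    [TopologicalSpace X] [NormalSpace X]
    [TopologicalSpace Y] [TietzeExtension.{u, v} Y] [Finite J] {A : J → Set X}
    (hA : ∀ j, IsClosed (A j)) (hd : Pairwise (Function.onFun Disjoint A)) (b : J → Y)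
    [Nonempty Y] : ∃ f : C(X, Y), ∀ j, ∀ x ∈ A j, f x = b j := by
  classical
  let g : X → Y := fun x => if h : ∃ j, x ∈ A j then b h.choose else Classical.arbitrary Y
  have hg : ∀ j, ∀ x ∈ A j, g x = b j := fun j x hx => by
    have h : ∃ j, x ∈ A j := ⟨j, hx⟩
    simp only [g, h, dif_pos]
    by_contra hne
    exact disjoint_left.1 (hd fun hj => hne (congrArg b hj)) h.choose_spec hx
  have hc : ContinuousOn g (⋃ j, A j) := (locallyFinite_of_finite A).continuousOn_iUnion hA
    fun j => continuousOn_const.congr fun x hx => hg j x hx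
  obtain ⟨f, hf⟩ := ContinuousMap.exists_restrict_eq (isClosed_iUnion_of_finite hA)
    ⟨(⋃ j, A j).domRestrict g, continuousOn_iff_continuous_domRestrict.1 hc⟩
  refine ⟨f, fun j x hx => ?_⟩
  rw [← hg j x hx]
  exact DFunLike.congr_fun hf ⟨x, mem_iUnion.2 ⟨j, hx⟩⟩

/-- A finite disjoint family of small closed pieces of a Z-set can be moved into a given dense open
set by a homeomorphism near the identity. -/
theorem IsZSet.exists_homeomorph_image_subset {K : Set HilbertCube} (hK : IsZSet K) {J : Type*}
    [Finite J] {A : J → Set HilbertCube} (hAc : ∀ j, IsClosed (A j))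
    (hAd : Pairwise (Function.onFun Disjoint A)) (hAK : ∀ j, A j ⊆ K) {N : ℕ} {e : ℝ}
    (he : 0 < e) (hA : ∀ j, ∀ x ∈ A j, ∀ y ∈ A j, CoordClose N e x y) {U : Set HilbertCube}
    (hUo : IsOpen U) (hUd : Dense U) :
    ∃ f : HilbertCube ≃ₜ HilbertCube, (∀ x, CoordClose N (7 * e) (f x) x) ∧
      ∀ j, ∀ x ∈ A j, f x ∈ U := by
  have hb (j : J) : ∃ b ∈ U, ∀ x ∈ A j, CoordClose N (2 * e) b x := by
    obtain h | ⟨a, ha⟩ := (A j).eq_empty_or_nonempty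
    · obtain ⟨b, hb⟩ := hUd.nonempty
      exact ⟨b, hb, by simp [h]⟩
    · obtain ⟨b, hb, hba⟩ := hUd.exists_coordClose a N he
      exact ⟨b, hb, fun x hx => (hba.symm.trans (hA j a ha x hx)).mono le_rfl (by linarith)⟩
  choose b hbU hbA using hb
  obtain ⟨f, hf⟩ := exists_continuousMap_eq_on_closed hAc hAd b
  obtain ⟨n, r, hr, hn⟩ := exists_coordClose_notMem (finite_range b).isCompact hUo.isClosed_compl
    (disjoint_left.2 (by rintro _ ⟨j, rfl⟩ h; exact h (hbU j)))
  obtain ⟨M, hM⟩ := exists_homeomorph_approx f (le_max_left N n) (r := 3 * e) (by positivity)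
    (half_pos hr)
  obtain ⟨m, s, hs, hm⟩ := exists_coordClose_of_continuous f.continuous (max N n)
    (r := min (r / 2) (e / 2)) (by positivity)
  obtain ⟨g, hg, d, hd, hgd⟩ := hK.exists_homeomorph_mem_Icc M (max N m) (e := min s (e / 2))
    (by positivity)
  have hfg (j : J) (x) (hx : x ∈ A j) :
      CoordClose (max N n) (min (r / 2) (e / 2)) (f (g x)) (b j) := by
    rw [← hf j x hx]
    exact hm _ _ ((hg x).mono (le_max_right _ _) (min_le_left _ _))
  obtain ⟨h, hh, hhf⟩ := hM d hd (g '' ⋃ j, A j)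
    (by
      rintro _ ⟨x, hx, rfl⟩ i hi
      obtain ⟨j, hj⟩ := mem_iUnion.1 hx
      exact hgd x (hAK j hj) i hi)
    (by
      rintro _ ⟨x, hx, rfl⟩
      obtain ⟨j, hj⟩ := mem_iUnion.1 hx
      have h1 := (hfg j x hj).mono (le_max_left N n) (min_le_right _ _)
      have h2 := (hg x).mono (le_max_left N m) (min_le_right _ _)
      exact ((h1.trans (hbA j x hj)).trans h2.symm).mono le_rfl (by linarith))
  refine ⟨g.trans h, fun x => ?_, fun j x hx => ?_⟩
  · have h2 := (hg x).mono (le_max_left N m) (min_le_right _ _)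
    exact ((hh (g x)).trans h2).mono le_rfl (by linarith)
  · have h1 := hhf (g x) (mem_image_of_mem g (mem_iUnion.2 ⟨j, hx⟩))
    have h2 := h1.trans ((hfg j x hx).mono le_rfl (min_le_left _ _))
    rw [add_halves] at h2
    exact not_not.1 (hn _ (mem_range_self j) _ (h2.mono (le_max_right _ _) le_rfl))

/-- A closed subset of a space of covering dimension at most `k` is covered by `k + 1` finite
disjoint families of small closed sets. -/
theorem CovDimLE.exists_closed_families {F : Set HilbertCube} {k : ℕ} (hF : CovDimLE ↥F k)
    {K : Set HilbertCube} (hK : IsClosed K) (hKF : K ⊆ F) (N : ℕ) {e : ℝ} (he : 0 < e) :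
    ∃ (J : Type) (_ : Finite J) (A : Fin (k + 1) → J → Set HilbertCube),
      (∀ i j, IsClosed (A i j)) ∧ (∀ i, Pairwise (Function.onFun Disjoint (A i))) ∧
      (∀ i j, A i j ⊆ K) ∧ (∀ i j, ∀ x ∈ A i j, ∀ y ∈ A i j, CoordClose N e x y) ∧
      ∀ x ∈ K, ∃ i j, x ∈ A i j := by
  classical
  obtain ⟨U, hUf, hUo, hUc, hU⟩ := exists_finite_cover_coordClose N he
  obtain ⟨V, hVf, hVo, hVc, hVU, hVn⟩ := hF ((fun W => Subtype.val ⁻¹' W) '' U) (hUf.image _)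
    (by rintro _ ⟨W, hW, rfl⟩; exact (hUo W hW).preimage continuous_subtype_val)
    (by rw [sUnion_image, ← preimage_iUnion₂, ← sUnion_eq_biUnion, hUc, preimage_univ])
  have : Fintype ↥V := hVf.fintype
  choose! O hO hOV using fun W (hW : W ∈ V) => isOpen_induced_iff.1 (hVo W hW)
  obtain ⟨f, hf⟩ := PartitionOfUnity.exists_isSubordinate hK (fun W : ↥V => O W)
    (fun W => hO W W.2) (fun x hx => by
      obtain ⟨W, hW, hxW⟩ := mem_sUnion.1 (hVc.symm ▸ mem_univ (⟨x, hKF hx⟩ : ↥F))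
      rw [← hOV W hW] at hxW
      exact mem_iUnion.2 ⟨⟨W, hW⟩, hxW⟩)
  have hfV {x} (hx : x ∈ F) {W : ↥V} (hW : 0 < f W x) : ⟨x, hx⟩ ∈ (W : Set ↥F) := by
    rw [← hOV W W.2]
    exact hf W (subset_tsupport _ hW.ne')
  let P : Finset ↥V → Set HilbertCube := fun S =>
    {x | S.Nonempty ∧ ∀ j ∈ S, 0 < f j x ∧ ∀ j' ∉ S, f j' x < f j x}
  have hPo (S : Finset ↥V) : IsOpen (P S) := by
    simp only [P, ofPred_and, ofPred_forall]
    refine isOpen_const.inter (isOpen_biInter_finset fun j _ => IsOpen.inter ?_ ?_)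
    · exact isOpen_lt continuous_const (f j).continuous
    · exact isOpen_iInter_of_finite fun j' => isOpen_iInter_of_finite fun _ =>
        isOpen_lt (f j').continuous (f j).continuous
  obtain ⟨C, hKC, hCc, hCP⟩ := exists_subset_iUnion_closed_subset hK hPo
    (fun x _ => toFinite _) (fun x hx => by
      obtain ⟨j₀, hj₀⟩ := f.exists_pos hx
      refine mem_iUnion.2 ⟨Finset.univ.filter fun j => ∀ j', f j' x ≤ f j x, ?_, ?_⟩
      · obtain ⟨j, -, hj⟩ := Finset.exists_max_image Finset.univ (fun j => f j x) ⟨j₀, by simp⟩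
        exact ⟨j, by simpa using hj⟩
      · intro j hj
        simp only [Finset.mem_filter, Finset.mem_univ, true_and, not_forall, not_le] at hj ⊢
        exact ⟨hj₀.trans_le (hj j₀), fun j' ⟨j'', h⟩ => h.trans_le (hj j'')⟩)
  refine ⟨Finset ↥V, inferInstance, fun i S => {x | S.card = i + 1 ∧ x ∈ C S ∧ x ∈ K}, fun i S => ?_,
    fun i S T hST => ?_, fun i S x hx => hx.2.2, fun i S x hx y hy => ?_, fun x hx => ?_⟩
  · exact isClosed_const.inter ((hCc S).inter hK)
  · refine disjoint_left.2 fun x hS hT => ?_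
    obtain ⟨j, hjS, hjT⟩ := Finset.not_subset.1 fun h =>
      hST (Finset.eq_of_subset_of_card_le h (hT.1.trans hS.1.symm).le)
    obtain ⟨j', hjT', hjS'⟩ := Finset.not_subset.1 fun h =>
      hST (Finset.eq_of_subset_of_card_le h (hS.1.trans hT.1.symm).le).symm
    exact lt_asymm (((hCP S hS.2.1).2 j hjS).2 j' hjS') (((hCP T hT.2.1).2 j' hjT').2 j hjT)
  · obtain ⟨j, hj⟩ := (hCP S hx.2.1).1
    obtain ⟨_, ⟨W, hW, rfl⟩, hjW⟩ := hVU j j.2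
    exact hU W hW x (hjW (hfV (hKF hx.2.2) ((hCP S hx.2.1).2 j hj).1)) y
      (hjW (hfV (hKF hy.2.2) ((hCP S hy.2.1).2 j hj).1))
  · obtain ⟨S, hS⟩ := mem_iUnion.1 (hKC hx)
    have h1 : S.card ≤ k + 1 := by
      refine le_trans ?_ (hVn ⟨x, hKF hx⟩)
      rw [← Finset.card_image_of_injective S Subtype.val_injective, ← ncard_coe_finset]
      refine ncard_le_ncard ?_ (hVf.subset (sep_subset _ _))
      intro W hW
      obtain ⟨j, hj, rfl⟩ := Finset.mem_image.1 hW
      exact ⟨j.2, hfV _ ((hCP S hS).2 j hj).1⟩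
    have h2 := (hCP S hS).1.card_pos
    exact ⟨⟨S.card - 1, by omega⟩, S, by simp only; omega, hS, hx⟩

section HomeoTopology

variable {X : Type*} [TopologicalSpace X]

/-- The forgetful map from self-homeomorphisms to continuous self-maps. -/
def homeoToContinuousMap (h : X ≃ₜ X) : C(X, X) := ⟨h, h.continuous⟩

theorem isInducing_homeoToContinuousMap : IsInducing (homeoToContinuousMap (X := X)) := ⟨rfl⟩

theorem injective_homeoToContinuousMap : Function.Injective (homeoToContinuousMap (X := X)) :=
  fun _ _ h => Homeomorph.ext fun x => DFunLike.congr_fun h x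

theorem continuous_homeo_symm [CompactSpace X] [T2Space X] :
    Continuous fun h : X ≃ₜ X => h.symm := by
  refine isInducing_homeoToContinuousMap.continuous_iff.2
    (ContinuousMap.continuous_compactOpen.2 fun K hK U hU => ?_)
  have : {h : X ≃ₜ X | MapsTo (homeoToContinuousMap h.symm) K U} =
      homeoToContinuousMap ⁻¹' {f | MapsTo f Uᶜ Kᶜ} := by
    ext h
    refine ⟨fun H x hx hxK => hx ?_, fun H x hx => ?_⟩
    · simpa [homeoToContinuousMap] using H hxK
    · by_contra hxU
      exact H hxU (by simpa [homeoToContinuousMap] using hx)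
  exact this ▸ (ContinuousMap.isOpen_setOfPred_mapsTo hU.isClosed_compl.isCompact
    hK.isClosed.isOpen_compl).preimage isInducing_homeoToContinuousMap.continuous

theorem isClosedEmbedding_homeo [CompactSpace X] [T2Space X] :
    IsClosedEmbedding fun h : X ≃ₜ X =>
      (homeoToContinuousMap h, homeoToContinuousMap h.symm) := by
  have hc := isInducing_homeoToContinuousMap (X := X).continuous
  refine ⟨⟨.of_comp (hc.prodMk (hc.comp continuous_homeo_symm)) continuous_fst
    isInducing_homeoToContinuousMap, fun g h hgh =>
      injective_homeoToContinuousMap (congrArg Prod.fst hgh)⟩, ?_⟩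
  have : range (fun h : X ≃ₜ X => (homeoToContinuousMap h, homeoToContinuousMap h.symm)) =
      {p : C(X, X) × C(X, X) | p.1.comp p.2 = .id X ∧ p.2.comp p.1 = .id X} := by
    ext ⟨f, g⟩
    constructor
    · rintro ⟨h, hh⟩
      obtain ⟨rfl, rfl⟩ := Prod.mk.inj hh
      exact ⟨ContinuousMap.ext h.apply_symm_apply, ContinuousMap.ext h.symm_apply_apply⟩
    · rintro ⟨h1, h2⟩
      exact ⟨⟨⟨f, g, DFunLike.congr_fun h2, DFunLike.congr_fun h1⟩, f.continuous, g.continuous⟩,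
        rfl⟩
  rw [this]
  refine (isClosed_eq ?_ continuous_const).inter (isClosed_eq ?_ continuous_const)
  · exact ContinuousMap.continuous_comp'.comp continuous_swap
  · exact ContinuousMap.continuous_comp'

end HomeoTopology

instance : TopologicalSpace.IsCompletelyMetrizableSpace (HilbertCube ≃ₜ HilbertCube) := by
  have : TopologicalSpace.IsCompletelyMetrizableSpace
      (C(HilbertCube, HilbertCube) × C(HilbertCube, HilbertCube)) := .prod
  exact isClosedEmbedding_homeo.IsCompletelyMetrizableSpace

theorem continuous_homeo_symm_eval {X : Type*} [TopologicalSpace X] [CompactSpace X] [T2Space X] :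
    Continuous fun p : (X ≃ₜ X) × X => p.1.symm p.2 := by
  have h := isInducing_homeoToContinuousMap.continuous.comp (continuous_homeo_symm (X := X))
  exact (continuous_eval (F := C(X, X))).comp (h.prodMap continuous_id)

theorem tendsto_homeo_of_coordClose {g : ℕ → HilbertCube ≃ₜ HilbertCube}
    {h : HilbertCube ≃ₜ HilbertCube}
    (hg : ∀ t x, CoordClose t (1 / ((t : ℝ) + 1)) (g t x) (h x)) :
    Filter.Tendsto g Filter.atTop (𝓝 h) := by
  rw [isInducing_homeoToContinuousMap.tendsto_nhds_iff, ContinuousMap.tendsto_iff_tendstoUniformly]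
  intro V hV
  obtain ⟨n, r, hr, hnr⟩ := exists_coordClose_subset hV
  obtain ⟨m, hm⟩ := exists_nat_one_div_lt hr
  filter_upwards [Filter.eventually_ge_atTop (max n m)] with t ht x
  refine hnr _ _ ((hg t x).symm.mono (by omega) (hm.le.trans' ?_))
  exact one_div_le_one_div_of_le (by positivity) (by gcongr; omega)

theorem mem_iUnion_image_homeo {X ι : Type*} [TopologicalSpace X] {h : ι → X ≃ₜ X} {V : Set X}
    {x : X} : x ∈ ⋃ i, h i '' V ↔ ∃ i, (h i).symm x ∈ V := by
  simp only [mem_iUnion, ← Homeomorph.preimage_symm, mem_preimage]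

theorem isOpen_setOf_subset_iUnion_image {X ι : Type*} [TopologicalSpace X] [CompactSpace X]
    [T2Space X] {Z V : Set X} (hZ : IsCompact Z) (hV : IsOpen V) :
    IsOpen {h : ι → X ≃ₜ X | Z ⊆ ⋃ i, h i '' V} := by
  refine isOpen_iff_eventually.2 fun h hh => ?_
  refine (hZ.eventually_forall_of_forall_eventually (P := fun (h : ι → X ≃ₜ X) x =>
    x ∈ ⋃ i, h i '' V) fun y hy => ?_).mono fun h hh x hx => hh x hx
  obtain ⟨i, hi⟩ := mem_iUnion_image_homeo.1 (hh hy)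
  have hc : Continuous fun p : (ι → X ≃ₜ X) × X => (p.1 i).symm p.2 :=
    (continuous_homeo_symm_eval (X := X)).comp
      (g := fun p : (X ≃ₜ X) × X => p.1.symm p.2) (f := fun p : (ι → X ≃ₜ X) × X => (p.1 i, p.2))
      (((continuous_apply i).comp continuous_fst).prodMk continuous_snd)
  filter_upwards [hc.continuousAt.preimage_mem_nhds (hV.mem_nhds hi)] with p hp
  exact mem_iUnion_image_homeo.2 ⟨i, hp⟩

theorem IsZSet.dense_setOf_subset_iUnion_image {Z F V : Set HilbertCube} (hZ : IsZSet Z)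
    (hZF : Z ⊆ F) {k : ℕ} (hF : CovDimLE ↥F k) (hVo : IsOpen V) (hVd : Dense V) :
    Dense {h : Fin (k + 1) → HilbertCube ≃ₜ HilbertCube | Z ⊆ ⋃ i, h i '' V} := by
  intro h
  have key (t : ℕ) : ∃ g : Fin (k + 1) → HilbertCube ≃ₜ HilbertCube,
      (∀ i x, CoordClose t (1 / ((t : ℝ) + 1)) (g i x) (h i x)) ∧ Z ⊆ ⋃ i, g i '' V := by
    have ht : 0 < 1 / ((t : ℝ) + 1) / 7 := by positivity
    obtain ⟨J, _, A, hAc, hAd, hAZ, hA, hZA⟩ := hF.exists_closed_families hZ.1 hZF t ht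
    choose f hf hfA using fun i => hZ.exists_homeomorph_image_subset (hAc i) (hAd i) (hAZ i) ht
      (hA i) ((h i).isOpen_image.2 hVo) ((h i).surjective.denseRange.dense_image (h i).continuous hVd)
    refine ⟨fun i => (h i).trans (f i).symm, fun i x => ?_, fun x hx => ?_⟩
    · have := hf i ((f i).symm (h i x))
      rw [Homeomorph.apply_symm_apply] at this
      exact this.symm.mono le_rfl (mul_div_cancel₀ _ (by norm_num)).le
    · obtain ⟨i, j, hj⟩ := hZA x hx
      obtain ⟨v, hv, hvx⟩ := hfA i j x hj
      exact mem_iUnion.2 ⟨i, v, hv, by simp [hvx]⟩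
  choose g hg hgZ using key
  exact mem_closure_of_tendsto
    (tendsto_pi_nhds.2 fun i => tendsto_homeo_of_coordClose fun t x => hg t i x)
    (Filter.Eventually.of_forall hgZ)

/-- For every dense `G_δ`-set `G` in the Hilbert cube and every σZ-set `F` of covering
dimension at most `k`, the set `H^{k+1}_{F,G}` is a dense `G_δ` in `H(I^ω)^{k+1}`. -/
theorem H_F_G_denseGdelta_of_sigmaZ (G F : Set HilbertCube)
    (hG : IsGδ G) (hGd : Dense G) (hF : IsSigmaZSet F)
    (k : ℕ) (hdim : CovDimLE ↥F k) :
    IsGδ {h : Fin (k + 1) → HilbertCube ≃ₜ HilbertCube | F ⊆ ⋃ i, (h i) '' G} ∧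
    Dense {h : Fin (k + 1) → HilbertCube ≃ₜ HilbertCube | F ⊆ ⋃ i, (h i) '' G} := by
  obtain ⟨Z, hZ, rfl⟩ := hF
  obtain ⟨f, hfo, rfl⟩ := isGδ_iff_eq_iInter_nat.1 hG
  let V : ℕ → Set HilbertCube := fun m => ⋂ j ∈ Iic m, f j
  have hVo (m : ℕ) : IsOpen (V m) := (finite_Iic m).isOpen_biInter fun j _ => hfo j
  have hV : Antitone V := fun m n hmn => biInter_subset_biInter_left (Iic_subset_Iic.2 hmn)
  have hVf : ⋂ m, V m = ⋂ m, f m := by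
    refine subset_antisymm (iInter_mono fun m => biInter_subset_of_mem self_mem_Iic) ?_
    exact subset_iInter fun m => subset_iInter₂ fun j _ => iInter_subset f j
  have hVd (m : ℕ) : Dense (V m) := hGd.mono (hVf ▸ iInter_subset V m)
  have key : {h : Fin (k + 1) → HilbertCube ≃ₜ HilbertCube | ⋃ n, Z n ⊆ ⋃ i, h i '' ⋂ m, f m} =
      ⋂ p : ℕ × ℕ, {h | Z p.1 ⊆ ⋃ i, h i '' V p.2} := by
    ext h
    simp only [mem_ofPred_eq, mem_iInter]
    refine ⟨fun H p x hx => ?_, fun H x hx => ?_⟩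
    · obtain ⟨i, hi⟩ := mem_iUnion_image_homeo.1 (H (mem_iUnion_of_mem p.1 hx))
      exact mem_iUnion_image_homeo.2 ⟨i, mem_iInter.1 (hVf ▸ hi) p.2⟩
    · obtain ⟨n, hn⟩ := mem_iUnion.1 hx
      rw [mem_iUnion_image_homeo, ← hVf]
      by_contra! hne
      simp only [mem_iInter, not_forall] at hne
      choose m hm using hne
      obtain ⟨i, hi⟩ := mem_iUnion_image_homeo.1 (H (n, Finset.univ.sup m) hn)
      exact hm i (hV (Finset.le_sup (Finset.mem_univ i)) hi)
  have ho (p : ℕ × ℕ) : IsOpen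
      {h : Fin (k + 1) → HilbertCube ≃ₜ HilbertCube | Z p.1 ⊆ ⋃ i, h i '' V p.2} :=
    isOpen_setOf_subset_iUnion_image (hZ p.1).1.isCompact (hVo p.2)
  rw [key]
  exact ⟨.iInter_of_isOpen ho, dense_iInter_of_isOpen ho fun p =>
    (hZ p.1).dense_setOf_subset_iUnion_image (subset_iUnion Z p.1) hdim (hVo p.2) (hVd p.2)⟩
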